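/- Fix n ≥ 2, a constant c with 0 < c ≤ n, and set p = c/n. For any fixed set S of k vertices (2 ≤ k ≤ n), the probability that S is a rigid component of the Erdős–Rényi random graph G(n, p) is at most P[Bin(k(k−1)/2, p) ≥ 2k−3] · ((1−p)^k + k·p·(1−p)^{k−1})^{n−k}, where Bin(N, p) denotes a binomial random variable with parameters N and p. (The two factors bound the independent events that S spans at least 2k−3 edges and that no vertex outside S has two or more neighbors in S.) -/

import Mathlib

open MeasureTheory Filter

noncomputable instance {n : ℕ} : MeasurableSpace (SimpleGraph (Fin n)) := ⊤

/-- The Bernoulli(p) measure on `Bool`. -/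
noncomputable def bernoulliMeasure (p : ℝ) : Measure Bool :=
  ENNReal.ofReal p • Measure.dirac true + ENNReal.ofReal (1 - p) • Measure.dirac false

/-- The Erdős–Rényi measure on simple graphs on `Fin n`: the pushforward to
`SimpleGraph (Fin n)` of the product Bernoulli(p) measure over unordered pairs
of distinct vertices. -/
noncomputable def erdosRenyi (n : ℕ) (p : ℝ) : Measure (SimpleGraph (Fin n)) :=
  Measure.map
    (fun f : ({e : Sym2 (Fin n) // ¬ e.IsDiag} → Bool) =>
      SimpleGraph.fromEdgeSet {e : Sym2 (Fin n) | ∃ h : ¬ e.IsDiag, f ⟨e, h⟩ = true})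
    (Measure.pi fun _ => bernoulliMeasure p)

/-- The edges of `G` spanned by the vertex set `S`. -/
def spannedEdges {n : ℕ} (G : SimpleGraph (Fin n)) (S : Finset (Fin n)) : Set (Sym2 (Fin n)) :=
  {e | e ∈ G.edgeSet ∧ ∀ v ∈ e, v ∈ S}

/-- `H` is a (2,3)-tight (Laman) graph on the vertex set `S`: all edges of `H` lie
inside `S`, every subset `T ⊆ S` with `|T| ≥ 2` spans at most `2|T| - 3` edges, and
`H` has exactly `2|S| - 3` edges. -/
def IsTightOn {n : ℕ} (H : SimpleGraph (Fin n)) (S : Finset (Fin n)) : Prop :=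
  (∀ e ∈ H.edgeSet, ∀ v ∈ e, v ∈ S) ∧
  (∀ T : Finset (Fin n), T ⊆ S → 2 ≤ T.card →
    (spannedEdges H T).ncard ≤ 2 * T.card - 3) ∧
  H.edgeSet.ncard = 2 * S.card - 3

/-- The induced subgraph `G[S]` is rigid: it contains a spanning (2,3)-tight subgraph. -/
def IsRigidOn {n : ℕ} (G : SimpleGraph (Fin n)) (S : Finset (Fin n)) : Prop :=
  ∃ H ≤ G, IsTightOn H S

/-- `S` is a rigid component of `G`: `|S| ≥ 2`, `G[S]` is rigid, and `S` is
inclusion-wise maximal with this property. -/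
def IsRigidComponent {n : ℕ} (G : SimpleGraph (Fin n)) (S : Finset (Fin n)) : Prop :=
  2 ≤ S.card ∧ IsRigidOn G S ∧
  ∀ S' : Finset (Fin n), S ⊆ S' → IsRigidOn G S' → S' = S

/-- `P[Bin(N, p) ≥ m]`: the upper tail of a binomial random variable with
parameters `N` and `p`. -/
noncomputable def binomialTail (N m : ℕ) (p : ℝ) : ℝ :=
  ∑ j ∈ Finset.Icc m N, (N.choose j : ℝ) * p ^ j * (1 - p) ^ (N - j)

theorem ncard_spannedEdges_le_one {n : ℕ} (G : SimpleGraph (Fin n)) {T : Finset (Fin n)}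
    (hT : T.card = 2) : (spannedEdges G T).ncard ≤ 1 := by
  obtain ⟨x, y, -, rfl⟩ := Finset.card_eq_two.1 hT
  have hsub : spannedEdges G {x, y} ⊆ {s(x, y)} := by
    rintro e ⟨he, hin⟩
    induction e with
    | _ a b =>
      have hab : a ≠ b := G.ne_of_adj he
      have ha := hin a (Sym2.mem_mk_left a b)
      have hb := hin b (Sym2.mem_mk_right a b)
      simp only [Finset.mem_insert, Finset.mem_singleton] at ha hb
      rw [Set.mem_singleton_iff, Sym2.eq_iff]
      grind
  simpa using Set.ncard_le_ncard hsub

/-- Attaching a new vertex by two edges preserves rigidity (a Henneberg 0-extension). -/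
theorem IsRigidOn.insert {n : ℕ} {G : SimpleGraph (Fin n)} {S : Finset (Fin n)}
    (hcard : 2 ≤ S.card) (hG : IsRigidOn G S) {u v w : Fin n} (hv : v ∉ S) (hu : u ∈ S)
    (hw : w ∈ S) (huw : u ≠ w) (huv : G.Adj u v) (hwv : G.Adj w v) :
    IsRigidOn G (insert v S) := by
  obtain ⟨H, hHG, hin, hsparse, htight⟩ := hG
  have hne : s(u, v) ≠ s(w, v) := by
    rw [Ne, Sym2.eq_iff]
    rintro (h | h)
    · exact huw h.1
    · exact huv.ne h.1
  have hedges : (H ⊔ SimpleGraph.fromEdgeSet {s(u, v), s(w, v)}).edgeSet =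
      H.edgeSet ∪ {s(u, v), s(w, v)} := by
    rw [SimpleGraph.edgeSet_sup, SimpleGraph.edgeSet_fromEdgeSet, sdiff_eq_left.2]
    rw [Set.disjoint_left]
    rintro e (rfl | rfl) he
    · exact huv.ne (by simpa using he)
    · exact hwv.ne (by simpa using he)
  have hvH : ∀ e ∈ H.edgeSet, v ∉ e := fun e he hve => hv (hin e he v hve)
  have hpair : ({s(u, v), s(w, v)} : Set (Sym2 (Fin n))).ncard = 2 := Set.ncard_pair hne
  refine ⟨H ⊔ SimpleGraph.fromEdgeSet {s(u, v), s(w, v)}, ?_, ?_, ?_, ?_⟩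
  · rw [← SimpleGraph.edgeSet_subset_edgeSet, hedges]
    rintro e (he | rfl | rfl)
    · exact SimpleGraph.edgeSet_subset_edgeSet.2 hHG he
    · exact huv
    · exact hwv
  · rw [hedges]
    rintro e (he | rfl | rfl) x hx
    · exact Finset.mem_insert_of_mem (hin e he x hx)
    · rcases Sym2.mem_iff.1 hx with rfl | rfl <;> simp [hu]
    · rcases Sym2.mem_iff.1 hx with rfl | rfl <;> simp [hw]
  · intro T hTS hT
    rcases hT.eq_or_lt with h2 | h2
    · have := ncard_spannedEdges_le_one
        (H ⊔ SimpleGraph.fromEdgeSet {s(u, v), s(w, v)}) h2.symm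
      omega
    by_cases hvT : v ∈ T
    · have hsub : spannedEdges (H ⊔ SimpleGraph.fromEdgeSet {s(u, v), s(w, v)}) T ⊆
          spannedEdges H (T.erase v) ∪ {s(u, v), s(w, v)} := by
        rintro e ⟨he, heT⟩
        rw [hedges] at he
        rcases he with he | he
        · refine Or.inl ⟨he, fun x hx => Finset.mem_erase.2 ⟨?_, heT x hx⟩⟩
          rintro rfl
          exact hvH e he hx
        · exact Or.inr he
      have hT' := Finset.card_erase_of_mem hvT
      have h1 := hsparse (T.erase v) (Finset.subset_insert_iff.1 hTS) (by omega)
      have h3 := (Set.ncard_le_ncard hsub).trans (Set.ncard_union_le _ _)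
      omega
    · refine (Set.ncard_le_ncard ?_).trans (hsparse T
        ((Finset.subset_insert_iff_of_notMem hvT).1 hTS) hT)
      rintro e ⟨he, heT⟩
      rw [hedges] at he
      rcases he with he | rfl | rfl
      · exact ⟨he, heT⟩
      · exact absurd (heT v (Sym2.mem_mk_right _ _)) hvT
      · exact absurd (heT v (Sym2.mem_mk_right _ _)) hvT
  · rw [hedges, Set.ncard_union_eq, htight, hpair, Finset.card_insert_of_notMem hv]
    · omega
    · rw [Set.disjoint_left]
      rintro e he (rfl | rfl)
      · exact hvH _ he (Sym2.mem_mk_right _ _)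
      · exact hvH _ he (Sym2.mem_mk_right _ _)

theorem isProbabilityMeasure_bernoulliMeasure {p : ℝ} (h0 : 0 ≤ p) (h1 : p ≤ 1) :
    IsProbabilityMeasure (bernoulliMeasure p) := by
  constructor
  simp [bernoulliMeasure, ← ENNReal.ofReal_add h0 (sub_nonneg.2 h1)]

/-- In a product of Bernoulli measures, the number of successes in a block of coordinates is
binomially distributed. -/
theorem pi_bernoulliMeasure_card_filter_mem {ι : Type*} [Fintype ι] {p : ℝ} (h0 : 0 ≤ p)
    (h1 : p ≤ 1) (B : Finset ι) (J : Finset ℕ) :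
    Measure.pi (fun _ : ι => bernoulliMeasure p)
        {f | (B.filter fun i => f i = true).card ∈ J} =
      ENNReal.ofReal (∑ j ∈ J, (B.card.choose j : ℝ) * p ^ j * (1 - p) ^ (B.card - j)) := by
  classical
  have := isProbabilityMeasure_bernoulliMeasure h0 h1
  have hq : 0 ≤ 1 - p := sub_nonneg.2 h1
  have hset : {f : ι → Bool | (B.filter fun i => f i = true).card ∈ J} =
      ⋃ A ∈ J.biUnion fun j => B.powersetCard j, (B : Set ι).pi fun i => {decide (i ∈ A)} := by
    ext f
    simp only [Set.mem_ofPred_eq, Set.mem_iUnion, Finset.mem_biUnion, Finset.mem_powersetCard,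
      Set.mem_pi, Set.mem_singleton_iff, exists_prop]
    constructor
    · intro h
      exact ⟨B.filter fun i => f i = true, ⟨_, h, Finset.filter_subset _ _, rfl⟩,
        fun i hi => by simp_all⟩
    · rintro ⟨A, ⟨j, hj, hAB, rfl⟩, hA⟩
      convert hj using 2
      ext i
      simp only [Finset.mem_filter]
      constructor
      · rintro ⟨hi, hfi⟩
        simpa [hfi] using hA i hi
      · exact fun hi => ⟨hAB hi, by simpa [hi] using hA i (hAB hi)⟩
  have hmeas (s : Set (ι → Bool)) : MeasurableSet s := .of_discrete
  rw [hset, measure_biUnion_finset _ fun _ _ => hmeas _, Finset.sum_biUnion,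
    ENNReal.ofReal_sum_of_nonneg fun _ _ => by positivity]
  · refine Finset.sum_congr rfl fun j _ => ?_
    have hA : ∀ A ∈ B.powersetCard j, Measure.pi (fun _ : ι => bernoulliMeasure p)
        ((B : Set ι).pi fun i => {decide (i ∈ A)}) =
          ENNReal.ofReal (p ^ j * (1 - p) ^ (B.card - j)) := by
      intro A hA
      obtain ⟨hAB, rfl⟩ := Finset.mem_powersetCard.1 hA
      rw [Measure.pi_pi_finset, ← Finset.prod_sdiff hAB,
        Finset.prod_congr rfl (g := fun _ => ENNReal.ofReal (1 - p)),
        Finset.prod_congr (s₁ := A) rfl (g := fun _ => ENNReal.ofReal p),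
        Finset.prod_const, Finset.prod_const, Finset.card_sdiff_of_subset hAB,
        ← ENNReal.ofReal_pow h0, ← ENNReal.ofReal_pow hq, ← ENNReal.ofReal_mul (by positivity),
        mul_comm]
      · intro i hi
        simp [bernoulliMeasure, hi]
      · intro i hi
        simp [bernoulliMeasure, (Finset.mem_sdiff.1 hi).2]
    rw [Finset.sum_congr rfl hA, Finset.sum_const, Finset.card_powersetCard, nsmul_eq_mul,
      mul_assoc, ENNReal.ofReal_mul (Nat.cast_nonneg _), ENNReal.ofReal_natCast]
  · intro i _ j _ hij
    rw [Function.onFun, Finset.disjoint_left]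
    intro A hi hj
    exact hij ((Finset.mem_powersetCard.1 hi).2.symm.trans (Finset.mem_powersetCard.1 hj).2)
  · intro A hA A' hA' hne
    rw [Function.onFun, Set.disjoint_left]
    intro f hf hf'
    simp only [Finset.coe_biUnion, Set.mem_iUnion, Finset.mem_coe, Finset.mem_powersetCard,
      exists_prop] at hA hA'
    obtain ⟨_, _, hAB, _⟩ := hA
    obtain ⟨_, _, hAB', _⟩ := hA'
    refine hne (Finset.ext fun i => ?_)
    by_cases hi : i ∈ B
    · simpa using (hf i hi).symm.trans (hf' i hi)
    · exact ⟨fun h => absurd (hAB h) hi, fun h => absurd (hAB' h) hi⟩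

/-- In a product measure, the numbers of successes in disjoint blocks are independent. -/
theorem pi_iInter_card_filter_mem {ι κ : Type*} [Fintype ι]
    (μ : Measure Bool) [IsProbabilityMeasure μ] (B : κ → Finset ι) (J : κ → Finset ℕ)
    (s : Finset κ) (hB : (s : Set κ).PairwiseDisjoint B) :
    Measure.pi (fun _ : ι => μ)
        {f | ∀ a ∈ s, ((B a).filter fun i => f i = true).card ∈ J a} =
      ∏ a ∈ s, Measure.pi (fun _ : ι => μ)
        {f | ((B a).filter fun i => f i = true).card ∈ J a} := by
  classical
  induction s using Finset.induction_on with
  | empty => simp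
  | insert a s ha ih =>
    rw [Finset.prod_insert ha, ← ih (hB.subset (by simp))]
    have hdisj : Disjoint (B a) (s.biUnion B) := by
      rw [Finset.disjoint_biUnion_right]
      intro b hb
      exact hB (by simp) (by simp [hb]) (by rintro rfl; exact ha hb)
    have hind : ProbabilityTheory.iIndepFun (fun (i : ι) (f : ι → Bool) => f i)
        (Measure.pi fun _ : ι => μ) :=
      ProbabilityTheory.iIndepFun_pi (X := fun _ => id) fun _ => aemeasurable_id
    have h := hind.indepFun_finset _ _ hdisj fun i => measurable_pi_apply i
    have hcount (T b) (hb : B b ⊆ T) (f : ι → Bool) :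
        ((B b).filter fun i => f i = true).card =
          (T.attach.filter fun i : T => (i : ι) ∈ B b ∧ f i = true).card := by
      rw [← Finset.card_map (Function.Embedding.subtype _)]
      congr 1
      ext i
      simp only [Finset.mem_filter, Finset.mem_map, Finset.mem_attach, true_and,
        Function.Embedding.subtype_apply, Subtype.exists, exists_and_right, exists_eq_right]
      exact ⟨fun hi => ⟨⟨hb hi.1, hi.1⟩, hi.2⟩, fun hi => ⟨hi.1.2, hi.2⟩⟩
    have h' := h.measure_inter_preimage_eq_mul
      {g | ((B a).attach.filter fun i : B a => (i : ι) ∈ B a ∧ g i = true).card ∈ J a}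
      {g | ∀ b ∈ s,
        ((s.biUnion B).attach.filter fun i : s.biUnion B => (i : ι) ∈ B b ∧ g i = true).card ∈ J b}
      .of_discrete .of_discrete
    convert h' using 2
    · ext f
      simp only [Finset.forall_mem_insert, Set.mem_ofPred_eq, Set.mem_inter_iff, Set.mem_preimage]
      rw [hcount _ a subset_rfl]
      refine and_congr_right fun _ => forall₂_congr fun b hb => ?_
      rw [hcount _ b (Finset.subset_biUnion_of_mem B hb)]
    · congr 1
      ext f
      simp only [Set.mem_ofPred_eq, Set.mem_preimage]
      rw [hcount _ a subset_rfl]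
    · congr 1
      ext f
      simp only [Set.mem_ofPred_eq, Set.mem_preimage]
      refine forall₂_congr fun b hb => ?_
      rw [hcount _ b (Finset.subset_biUnion_of_mem B hb)]

theorem rigid_component_not_adj_two {n : ℕ} {G : SimpleGraph (Fin n)} {S : Finset (Fin n)}
    (hG : IsRigidComponent G S) {u v w : Fin n} (hv : v ∉ S) (hu : u ∈ S) (hw : w ∈ S)
    (huv : G.Adj u v) (hwv : G.Adj w v) : u = w := by
  by_contra huw
  have h := hG.2.2 _ (Finset.subset_insert v S) (hG.2.1.insert hG.1 hv hu hw huw huv hwv)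
  exact hv (h ▸ Finset.mem_insert_self v S)

/-- The potential edges inside `S` (index `none`), or between `S` and `v` (index `some v`). -/
def edgeBlock {n : ℕ} (S : Finset (Fin n)) :
    Option (Fin n) → Finset {e : Sym2 (Fin n) // ¬ e.IsDiag}
  | none => Finset.univ.filter fun e => ∀ v ∈ e.1, v ∈ S
  | some v => Finset.univ.filter fun e => ∃ u ∈ S, e.1 = s(u, v)

theorem card_edgeBlock_none {n : ℕ} (S : Finset (Fin n)) :
    (edgeBlock S none).card = S.card * (S.card - 1) / 2 := by
  rw [← Nat.choose_two_right, ← Sym2.card_image_offDiag,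
    ← Finset.card_map (Function.Embedding.subtype _)]
  congr 1
  ext e
  induction e with
  | _ a b =>
    simp only [edgeBlock, Finset.mem_map, Finset.mem_filter, Finset.mem_univ, true_and,
      Function.Embedding.subtype_apply, Subtype.exists, exists_and_left, exists_prop,
      Finset.mem_image, Finset.mem_offDiag, Prod.exists, Function.uncurry_apply_pair]
    constructor
    · rintro ⟨e, h, he, rfl⟩
      exact ⟨a, b, ⟨h a (Sym2.mem_mk_left _ _), h b (Sym2.mem_mk_right _ _), by simpa using he⟩,
        rfl⟩
    · rintro ⟨x, y, ⟨hx, hy, hxy⟩, h⟩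
      refine ⟨s(x, y), ?_, by simpa using hxy, h⟩
      intro v hv
      rcases Sym2.mem_iff.1 hv with rfl | rfl <;> assumption

theorem card_edgeBlock_some {n : ℕ} {S : Finset (Fin n)} {v : Fin n} (hv : v ∉ S) :
    (edgeBlock S (some v)).card = S.card := by
  symm
  refine Finset.card_bij (fun u hu => ⟨s(u, v), ?_⟩) ?_ ?_ ?_
  · rw [Sym2.mk_isDiag_iff]
    rintro rfl
    exact hv hu
  · intro u hu
    simpa [edgeBlock] using ⟨u, hu, Or.inl rfl⟩
  · intro u hu w hw h
    rcases Sym2.eq_iff.1 (Subtype.mk.inj h) with h | h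
    · exact h.1
    · exact absurd (h.1 ▸ hu) hv
  · rintro ⟨e, he⟩ h
    simp only [edgeBlock, Finset.mem_filter, Finset.mem_univ, true_and] at h
    obtain ⟨u, hu, rfl⟩ := h
    exact ⟨u, hu, rfl⟩

theorem pairwiseDisjoint_edgeBlock {n : ℕ} (S : Finset (Fin n)) :
    ((Finset.insertNone Sᶜ : Finset (Option (Fin n))) : Set (Option (Fin n))).PairwiseDisjoint
      (edgeBlock S) := by
  intro a ha b hb hab
  rw [Function.onFun, Finset.disjoint_left]
  rintro ⟨e, he⟩ hea heb
  rcases a with _ | v <;> rcases b with _ | w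
  · exact hab rfl
  all_goals
    simp only [edgeBlock, Finset.mem_filter, Finset.mem_univ, true_and, Finset.mem_coe,
      Finset.some_mem_insertNone, Finset.mem_compl] at ha hb hea heb
  · obtain ⟨u, hu, rfl⟩ := heb
    exact hb (hea w (Sym2.mem_mk_right _ _))
  · obtain ⟨u, hu, rfl⟩ := hea
    exact ha (heb v (Sym2.mem_mk_right _ _))
  · obtain ⟨u, hu, rfl⟩ := hea
    obtain ⟨x, hx, h⟩ := heb
    rcases Sym2.eq_iff.1 h with ⟨-, rfl⟩ | ⟨rfl, -⟩
    · exact hab rfl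
    · exact hb hu

/-- The numbers of present edges in the blocks that a rigid component on `k` vertices allows. -/
def admissibleCounts {α : Type*} (k : ℕ) : Option α → Finset ℕ
  | none => Finset.Icc (2 * k - 3) (k * (k - 1) / 2)
  | some _ => Finset.range 2

theorem IsRigidComponent.card_edgeBlock_mem {n : ℕ} {S : Finset (Fin n)}
    {f : {e : Sym2 (Fin n) // ¬ e.IsDiag} → Bool}
    (hf : IsRigidComponent
      (SimpleGraph.fromEdgeSet {e : Sym2 (Fin n) | ∃ h : ¬ e.IsDiag, f ⟨e, h⟩ = true}) S)
    {a : Option (Fin n)} (ha : a ∈ Finset.insertNone Sᶜ) :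
    ((edgeBlock S a).filter fun e => f e = true).card ∈ admissibleCounts S.card a := by
  rcases a with _ | v
  · obtain ⟨H, hH, hin, -, hcard⟩ := hf.2.1
    rw [admissibleCounts, Finset.mem_Icc, ← card_edgeBlock_none]
    refine ⟨?_, Finset.card_filter_le _ _⟩
    rw [← hcard, ← Finset.card_map (Function.Embedding.subtype _), ← Set.ncard_coe_finset]
    refine Set.ncard_le_ncard fun e he => ?_
    have he' := SimpleGraph.edgeSet_subset_edgeSet.2 hH he
    rw [SimpleGraph.edgeSet_fromEdgeSet] at he'
    obtain ⟨⟨hd, hfe⟩, -⟩ := he'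
    simp only [edgeBlock, Finset.coe_map, Set.mem_image, Finset.mem_coe, Finset.mem_filter,
      Finset.mem_univ, true_and]
    exact ⟨⟨e, hd⟩, ⟨hin e he, hfe⟩, rfl⟩
  · have hv : v ∉ S := by simpa using ha
    rw [admissibleCounts, Finset.mem_range, Nat.lt_succ_iff, Finset.card_le_one]
    rintro ⟨e, he⟩ hea ⟨e', he'⟩ heb
    simp only [edgeBlock, Finset.mem_filter, Finset.mem_univ, true_and] at hea heb
    obtain ⟨⟨u, hu, rfl⟩, hfu⟩ := hea
    obtain ⟨⟨w, hw, rfl⟩, hfw⟩ := heb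
    have huw := rigid_component_not_adj_two hf hv hu hw
      ((SimpleGraph.fromEdgeSet_adj _).2 ⟨⟨he, hfu⟩, by simpa using he⟩)
      ((SimpleGraph.fromEdgeSet_adj _).2 ⟨⟨he', hfw⟩, by simpa using he'⟩)
    simp [huw]

/-- For a fixed set `S` of `k` vertices, the probability that `S` is a rigid
component of `G(n, p)` with `p = c/n` is at most
`P[Bin(k(k-1)/2, p) ≥ 2k-3] · ((1-p)^k + k·p·(1-p)^(k-1))^(n-k)`. -/
theorem component_probability_bound (n : ℕ) (hn : 2 ≤ n) (c : ℝ) (hc : 0 < c)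
    (hcn : c ≤ n) (p : ℝ) (hp : p = c / n) (k : ℕ) (hk2 : 2 ≤ k) (hkn : k ≤ n)
    (S : Finset (Fin n)) (hS : S.card = k) :
    erdosRenyi n p {G | IsRigidComponent G S} ≤
      ENNReal.ofReal
        (binomialTail (k * (k - 1) / 2) (2 * k - 3) p *
          ((1 - p) ^ k + k * p * (1 - p) ^ (k - 1)) ^ (n - k)) := by

  have hn0 : (0 : ℝ) < n := by exact_mod_cast (by omega : 0 < n)
  have h0 : 0 ≤ p := hp ▸ (div_pos hc hn0).le
  have h1 : p ≤ 1 := hp ▸ (div_le_one hn0).2 hcn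
  have hq : 0 ≤ 1 - p := sub_nonneg.2 h1
  have := isProbabilityMeasure_bernoulliMeasure h0 h1
  subst hS
  rw [erdosRenyi, Measure.map_apply .of_discrete MeasurableSpace.measurableSet_top]
  have hsub : (fun f : {e : Sym2 (Fin n) // ¬ e.IsDiag} → Bool =>
      SimpleGraph.fromEdgeSet {e : Sym2 (Fin n) | ∃ h : ¬ e.IsDiag, f ⟨e, h⟩ = true}) ⁻¹'
        {G | IsRigidComponent G S} ⊆
      {f | ∀ a ∈ Finset.insertNone Sᶜ,
        ((edgeBlock S a).filter fun e => f e = true).card ∈ admissibleCounts S.card a} :=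
    fun f hf a ha => IsRigidComponent.card_edgeBlock_mem hf ha
  refine (measure_mono hsub).trans (le_of_eq ?_)
  rw [pi_iInter_card_filter_mem _ _ _ _ (pairwiseDisjoint_edgeBlock S)]
  have hsome : ∀ v ∈ Sᶜ, Measure.pi (fun _ => bernoulliMeasure p)
      {f | ((edgeBlock S (some v)).filter fun i => f i = true).card ∈
        admissibleCounts S.card (some v)} =
      ENNReal.ofReal ((1 - p) ^ S.card + S.card * p * (1 - p) ^ (S.card - 1)) := by
    intro v hv
    rw [pi_bernoulliMeasure_card_filter_mem h0 h1, card_edgeBlock_some (Finset.mem_compl.1 hv)]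
    simp [admissibleCounts, Finset.sum_range_succ]
  rw [Finset.prod_insertNone, Finset.prod_congr rfl hsome, Finset.prod_const, Finset.card_compl,
    Fintype.card_fin, pi_bernoulliMeasure_card_filter_mem h0 h1, card_edgeBlock_none,
    ← ENNReal.ofReal_pow (by positivity), ← ENNReal.ofReal_mul]
  · rfl
  · exact Finset.sum_nonneg fun _ _ => by positivity
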